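/- arXiv:1401.5691 — 2 statements merged into one kernel-verified Lean document; each statement's English description precedes it below -/
import Mathlib

section
/- Let u : ℤ² → ℝ satisfy equation (kj11): (u_{n,m} + u_{n+1,m+1})·u_{n+1,m}·u_{n,m+1} + 1 = 0 for all (n,m) ∈ ℤ², with u_{n,m} ≠ 0 and u_{n−1,m} u_{n,m} u_{n+1,m} ≠ 1 for all (n,m). Define t_{n,m} := 1/(u_{n−1,m} u_{n,m} u_{n+1,m} − 1). Then t satisfies equation (Carandini6): (t_{n+1,m+1} + t_{n+1,m} + 1)(t_{n,m+1} + t_{n,m} + 1) − (t_{n+1,m} + 1)(t_{n,m+1} + 1) = 0 for all (n,m) ∈ ℤ². -/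
/-- The Mikhailov–Xenitidis equation (kj11) for a field `u : ℤ² → ℝ`. -/
def Kj11 (u : ℤ → ℤ → ℝ) : Prop :=
  ∀ n m : ℤ,
    (u n m + u (n+1) (m+1)) * u (n+1) m * u n (m+1) + 1 = 0

/-- Equation (Carandini6) for a field `t : ℤ² → ℝ`. -/
def Carandini6 (t : ℤ → ℤ → ℝ) : Prop :=
  ∀ n m : ℤ,
    (t (n+1) (m+1) + t (n+1) m + 1) * (t n (m+1) + t n m + 1)
      - (t (n+1) m + 1) * (t n (m+1) + 1) = 0

lemma kj_aux (a0 a1 a2 a3 b0 b1 b2 b3 : ℝ)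
    (e0 : (a0 + b1) * a1 * b0 + 1 = 0) (e1 : (a1 + b2) * a2 * b1 + 1 = 0)
    (e2 : (a2 + b3) * a3 * b2 + 1 = 0)
    (ha1 : a1 ≠ 0) (ha2 : a2 ≠ 0) (ha3 : a3 ≠ 0) (hb0 : b0 ≠ 0) (hb1 : b1 ≠ 0) (hb2 : b2 ≠ 0) :
    (b1*b2*b3*(a1*a2*a3) - 1) * (b0*b1*b2*(a0*a1*a2) - 1)
      = (a1*a2*a3) * (b0*b1*b2) * (b1*b2*b3 - 1) * (a0*a1*a2 - 1) := by
  have p0 : a0 * a1 * b0 = -1 - a1 * b0 * b1 := by linarith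
  have p2 : a3 * b2 * b3 = -1 - a2 * a3 * b2 := by linarith
  have p1 : a1 * a2 * b1 = -1 - a2 * b1 * b2 := by linarith
  grind

/-- The transformation (kj12) maps solutions of (kj11) to solutions of
(Carandini6). -/
theorem kj11_to_carandini6 (u : ℤ → ℤ → ℝ) (hu : Kj11 u)
    (hu0 : ∀ n m : ℤ, u n m ≠ 0)
    (hu1 : ∀ n m : ℤ, u (n-1) m * u n m * u (n+1) m ≠ 1)
    (t : ℤ → ℤ → ℝ)
    (ht : ∀ n m : ℤ, t n m = 1 / (u (n-1) m * u n m * u (n+1) m - 1)) :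
    Carandini6 t := by
  intro n m
  have e0 := hu (n-1) m
  have e1 := hu n m
  have e2 := hu (n+1) m
  have h1 := hu1 n m
  have h2 := hu1 n (m+1)
  have h3 := hu1 (n+1) m
  have h4 := hu1 (n+1) (m+1)
  rw [ht, ht, ht, ht]
  simp only [sub_add_cancel, add_sub_cancel_right] at *
  have key := kj_aux _ _ _ _ _ _ _ _ e0 e1 e2 (hu0 _ _) (hu0 _ _) (hu0 _ _) (hu0 _ _) (hu0 _ _) (hu0 _ _)
  generalize u (n-1) m * u n m * u (n+1) m = P0 at *
  generalize u (n-1) (m+1) * u n (m+1) * u (n+1) (m+1) = Q0 at *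
  generalize u n m * u (n+1) m * u (n+1+1) m = P1 at *
  generalize u n (m+1) * u (n+1) (m+1) * u (n+1+1) (m+1) = Q1 at *
  have h1 := sub_ne_zero.2 h1
  have h2 := sub_ne_zero.2 h2
  have h3 := sub_ne_zero.2 h3
  have h4 := sub_ne_zero.2 h4
  field_simp
  linear_combination key
end

section
/- Let λ ∈ ℝ with λ ≠ 0, and let t : ℤ² → ℝ satisfy equation (Carandini6): (t_{n+1,m+1} + t_{n+1,m} + 1)(t_{n,m+1} + t_{n,m} + 1) − (t_{n+1,m} + 1)(t_{n,m+1} + 1) = 0 for all (n,m) ∈ ℤ², with t_{n,m} ≠ 0, t_{n,m} + 1 ≠ 0 and t_{n,m+1} + t_{n,m} + 1 ≠ 0 for all (n,m). With the 3×3 real matrices M̃_{n,m} := [[0, 1 + 1/t_{n−1,m}, 0], [−1, −1 − 1/t_{n−1,m}, λ], [−1, 0, 1]] and Ñ_{n,m} := [[0, 0, 1], [1 + ρ_{n,m}, 0, −1 − ρ_{n,m}], [1/λ, −ρ_{n,m}/λ, 0]], where ρ_{n,m} := t_{n,m+1}·(t_{n−1,m} + 1)/(t_{n−1,m}·(t_{n,m}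 + 1)), define Y_{n,m} := (t_{n+1,m}/(t_{n+1,m} + 1))·M̃_{n+2,m}·M̃_{n+1,m}·M̃_{n,m} and X_{n,m} := −((t_{n,m+1} + 1)(t_{n,m} + 1)/(t_{n,m+2}·(t_{n,m+1} + t_{n,m} + 1)))·Ñ_{n,m+2}·Ñ_{n,m+1}·Ñ_{n,m}. Then the local Lax compatibility condition holds: for all (n,m) ∈ ℤ², X_{n+3,m}·Y_{n,m} = Y_{n,m+3}·X_{n,m}. -/
theorem lax_scalar (s w t r : ℤ → ℤ → ℝ)
    (hs : ∀ i j, s i j ≠ 0) (hw : ∀ i j, w i j ≠ 0) (ht : ∀ i j, t i j ≠ 0)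
    (h1 : ∀ i j, w (i+1) j = s (i+1) j * s i (j+1) / w i j)
    (h2 : ∀ i j, t (i+1) (j+1) = -(t i j * s (i+1) j / w i j))
    (hr : ∀ i j, r (i+1) j = -(s i j / w i j)) (n m : ℤ) :
    (-(s (n+3) (m+1) * s (n+3) m / (t (n+3) (m+2) * w (n+3) m)))
      * (t (n+1) m / s (n+1) m)
      * ((r (n+1) m * r (n+2) m * r (n+3) m) * (r (n+1) (m+1) * r (n+2) (m+1) * r (n+3) (m+1))
        * (r (n+1) (m+2) * r (n+2) (m+2) * r (n+3) (m+2)))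
    = (t (n+1) (m+3) / s (n+1) (m+3)) *
      (-(s n (m+1) * s n m / (t n (m+2) * w n m))) := by
  have e3 : n + 3 = n + 2 + 1 := by ring
  have e2 : n + 2 = n + 1 + 1 := by ring
  have f2 : m + 2 = m + 1 + 1 := by ring
  have f3 : m + 3 = m + 2 + 1 := by ring
  have a1 := h1 (n+2) m
  have a2 := h2 (n+2) (m+1)
  have a3 := h1 (n+1) (m+2)
  have a4 := h2 (n+1) m
  have a5 := h2 n (m+2)
  have a6 := h1 n m
  have a7 := h1 n (m+1)
  have a8 := h1 n (m+2)
  have b1 := fun j => hr n j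
  have b2 := fun j => hr (n+1) j
  have b3 := fun j => hr (n+2) j
  rw [← e3] at a1 a2 b3
  rw [← e2] at a3 a4 b2
  rw [← f2] at a2 a7
  rw [← f3] at a3 a5 a8
  simp only [b1, b2, b3]
  rw [a1, a2, a3, a4, a5, a6, a7, a8]
  have := hs n m
  have := hs n (m+1)
  have := hs n (m+2)
  have := hs n (m+3)
  have := hs (n+1) m
  have := hs (n+1) (m+1)
  have := hs (n+1) (m+2)
  have := hs (n+1) (m+3)
  have := hs (n+2) m
  have := hs (n+2) (m+1)
  have := hs (n+2) (m+2)
  have := hs (n+3) m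
  have := hs (n+3) (m+1)
  have := hw n m
  have := hw n (m+1)
  have := hw n (m+2)
  have := hw (n+2) m
  have := hw (n+2) (m+1)
  have := ht (n+1) m
  have := ht n (m+2)
  field_simp

theorem lax_three {A : Type*} [Ring A] [Algebra ℝ A] (M N : ℤ → ℤ → A) (r : ℤ → ℤ → ℝ)
    (h : ∀ n m, N (n+1) m * M n m = r (n+1) m • (M n (m+1) * N n m)) (n m : ℤ) :
    N (n+3) m * (M (n+2) m * M (n+1) m * M n m)
      = (r (n+1) m * r (n+2) m * r (n+3) m) •
        ((M (n+2) (m+1) * M (n+1) (m+1) * M n (m+1)) * N n m) := by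
  have h1 := h n m
  have h2 := h (n+1) m
  have h3 := h (n+2) m
  rw [show n + 1 + 1 = n + 2 by ring] at h2
  rw [show n + 2 + 1 = n + 3 by ring] at h3
  calc _ = (N (n+3) m * M (n+2) m) * M (n+1) m * M n m := by noncomm_ring
    _ = r (n+3) m • (M (n+2) (m+1) * (N (n+2) m * M (n+1) m) * M n m) := by
      rw [h3]; simp only [smul_mul_assoc, mul_assoc]
    _ = (r (n+3) m * r (n+2) m) • (M (n+2) (m+1) * M (n+1) (m+1) * (N (n+1) m * M n m)) := by
      rw [h2]; simp only [smul_mul_assoc, mul_smul_comm, mul_assoc, smul_smul]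
    _ = _ := by
      rw [h1]; simp only [mul_smul_comm, mul_assoc, smul_smul]
      congr 1; ring

/-- The local Lax compatibility condition for the three-step transfer
matrices (Carandini20), (Carandini21) of equation (Carandini6). -/
theorem carandini6_local_lax (lam : ℝ) (hlam : lam ≠ 0)
    (t : ℤ → ℤ → ℝ) (hT : Carandini6 t)
    (ht0 : ∀ n m : ℤ, t n m ≠ 0) (ht1 : ∀ n m : ℤ, t n m + 1 ≠ 0)
    (ht2 : ∀ n m : ℤ, t n (m+1) + t n m + 1 ≠ 0)
    (ρ : ℤ → ℤ → ℝ)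
    (hρ : ∀ n m : ℤ,
      ρ n m = t n (m+1) * (t (n-1) m + 1) / (t (n-1) m * (t n m + 1)))
    (M N : ℤ → ℤ → Matrix (Fin 3) (Fin 3) ℝ)
    (hM : ∀ n m : ℤ, M n m =
      !![0, 1 + 1 / t (n-1) m, 0;
         -1, -1 - 1 / t (n-1) m, lam;
         -1, 0, 1])
    (hN : ∀ n m : ℤ, N n m =
      !![0, 0, 1;
         1 + ρ n m, 0, -1 - ρ n m;
         1 / lam, -ρ n m / lam, 0])
    (Y X : ℤ → ℤ → Matrix (Fin 3) (Fin 3) ℝ)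
    (hY : ∀ n m : ℤ, Y n m =
      (t (n+1) m / (t (n+1) m + 1)) • (M (n+2) m * M (n+1) m * M n m))
    (hX : ∀ n m : ℤ, X n m =
      (-((t n (m+1) + 1) * (t n m + 1)
          / (t n (m+2) * (t n (m+1) + t n m + 1)))) •
        (N n (m+2) * N n (m+1) * N n m)) :
    ∀ n m : ℤ, X (n+3) m * Y n m = Y n (m+3) * X n m := by
  have hw1 : ∀ i j, t (i+1) (j+1) = -(t i j * (t (i+1) j + 1) / (t i (j+1) + t i j + 1)) := by
    intro i j
    have := hT i j
    have h0 := ht2 i j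
    rw [← neg_div, eq_div_iff h0]
    linarith
  have hw2 : ∀ i j, t (i+1) (j+1) + t (i+1) j + 1
      = (t (i+1) j + 1) * (t i (j+1) + 1) / (t i (j+1) + t i j + 1) := by
    intro i j
    have := hT i j
    rw [eq_div_iff (ht2 i j)]
    linarith
  have hr : ∀ i j, ρ (i+1) j = -((t i j + 1) / (t i (j+1) + t i j + 1)) := by
    intro i j
    rw [hρ, hw1, show i + 1 - 1 = i by ring]
    have := ht0 i j
    have := ht1 (i+1) j
    have := ht2 i j
    field_simp
  have key : ∀ n m, N (n+1) m * M n m = ρ (n+1) m • (M n (m+1) * N n m) := by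
    intro n m
    obtain ⟨k, rfl⟩ : ∃ k, n = k + 1 := ⟨n - 1, by ring⟩
    have c1 : ρ (k+1+1) m * (1 + ρ (k+1) m) * (1 + 1 / t k (m+1)) = -1 := by
      have q0 := ht2 k m
      have q1 := ht2 (k+1) m
      have q2 := ht0 k (m+1)
      have q3 := ht1 k (m+1)
      have q4 := ht1 (k+1) m
      rw [hr, hr, hw2]
      field_simp
      ring
    have c2 : (1 + 1 / t k m) * (1 + ρ (k+1+1) m) = - (ρ (k+1) m * ρ (k+1+1) m) := by
      have q0 := ht2 k m
      have q1 := ht2 (k+1) m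
      have q2 := ht0 k m
      have e : 1 + ρ (k+1+1) m = t (k+1) (m+1) / (t (k+1) (m+1) + t (k+1) m + 1) := by
        rw [hr]; field_simp; ring
      rw [e, hr, hr]
      have e2 := hT k m
      field_simp
      linear_combination (t k m + 1) * e2
    rw [hN, hN, hM, hM, show k + 1 - 1 = k by ring]
    generalize ρ (k+1+1) m = r' at *
    generalize ρ (k+1) m = r at *
    generalize 1 / t k m = a at *
    generalize 1 / t k (m+1) = b at *
    ext i j
    fin_cases i <;> fin_cases j <;>
      simp [Matrix.mul_apply, Fin.sum_univ_three] <;> field_simp <;>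
      first
      | done
      | ring1
      | linear_combination c1
      | linear_combination -c1
      | linear_combination c2
      | linear_combination -c2
  intro n m
  have k0 := lax_three M N ρ key n m
  have k1 := lax_three M N ρ key n (m+1)
  have k2 := lax_three M N ρ key n (m+2)
  rw [show m + 1 + 1 = m + 2 by ring] at k1
  rw [show m + 2 + 1 = m + 3 by ring] at k2
  have sc := lax_scalar (fun i j => t i j + 1) (fun i j => t i (j+1) + t i j + 1) t ρ
    ht1 ht2 ht0 hw2 hw1 hr n m

  rw [hX, hY, hX, hY]
  simp only [smul_mul_assoc, mul_smul_comm, smul_smul]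
  generalize M (n+2) m * M (n+1) m * M n m = P0 at *
  generalize M (n+2) (m+1) * M (n+1) (m+1) * M n (m+1) = P1 at *
  generalize M (n+2) (m+2) * M (n+1) (m+2) * M n (m+2) = P2 at *
  generalize M (n+2) (m+3) * M (n+1) (m+3) * M n (m+3) = P3 at *
  have fin : N (n+3) (m+2) * N (n+3) (m+1) * N (n+3) m * P0 =
      ((ρ (n+1) m * ρ (n+2) m * ρ (n+3) m) * (ρ (n+1) (m+1) * ρ (n+2) (m+1) * ρ (n+3) (m+1))
        * (ρ (n+1) (m+2) * ρ (n+2) (m+2) * ρ (n+3) (m+2))) •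
      (P3 * (N n (m+2) * N n (m+1) * N n m)) := by
    rw [mul_assoc, k0, mul_smul_comm, mul_assoc (N (n+3) (m+2)), ← mul_assoc (N (n+3) (m+1)), k1,
      smul_mul_assoc, mul_smul_comm, mul_assoc P2, ← mul_assoc (N (n+3) (m+2)), k2,
      smul_mul_assoc, smul_smul, smul_smul]
    simp only [mul_assoc]
  rw [fin, smul_smul]
  congr 1
  first
  | exact sc
  | linear_combination sc
end
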